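/- arXiv:2411.18318 — 5 statements merged into one kernel-verified Lean document; each statement's English description precedes it below -/
import Mathlib

section
/- Let L be a nontrivial real Hilbert space, R : L → L an operator, and α a nonzero real number. Then SRG(α·R) = SRG(R ∘ (α·id)) = α·SRG(R), where α·R is the operator u ↦ α·(R u), R ∘ (α·id) is the operator u ↦ R(α·u), and α·SRG(R) := {α·z : z ∈ SRG(R)} ⊆ ℂ. -/
open scoped Pointwise

/-- The pair of complex numbers
`(‖Ru₁−Ru₂‖/‖u₁−u₂‖)·exp(±i·∠(u₁−u₂, Ru₁−Ru₂))` (which reduces to `{0}` when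
`Ru₁ = Ru₂`). -/
noncomputable def zR {L : Type*} [NormedAddCommGroup L] [InnerProductSpace ℝ L]
    (R : L → L) (u₁ u₂ : L) : Set ℂ :=
  {((‖R u₁ - R u₂‖ / ‖u₁ - u₂‖ : ℝ) : ℂ) *
      Complex.exp (Complex.I * (InnerProductGeometry.angle (u₁ - u₂) (R u₁ - R u₂) : ℝ)),
   ((‖R u₁ - R u₂‖ / ‖u₁ - u₂‖ : ℝ) : ℂ) *
      Complex.exp (-(Complex.I * (InnerProductGeometry.angle (u₁ - u₂) (R u₁ - R u₂) : ℝ)))}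

/-- The Scaled Relative Graph of an operator `R`. -/
noncomputable def SRG {L : Type*} [NormedAddCommGroup L] [InnerProductSpace ℝ L]
    (R : L → L) : Set ℂ :=
  ⋃ (u₁ : L) (u₂ : L) (_ : u₁ ≠ u₂), zR R u₁ u₂

theorem zR_const_smul {L : Type*} [NormedAddCommGroup L] [InnerProductSpace ℝ L]
    (R : L → L) {α : ℝ} (hα : α ≠ 0) (u₁ u₂ : L) :
    zR (fun u => α • R u) u₁ u₂ = (fun z : ℂ => (α : ℂ) * z) '' zR R u₁ u₂ := by
  rcases hα.lt_or_gt with h | h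
  · simp only [zR, ← smul_sub, norm_smul, Real.norm_eq_abs, abs_of_neg h, Set.image_pair,
      InnerProductGeometry.angle_smul_right_of_neg _ _ h, InnerProductGeometry.angle_neg_right]
    rw [Set.pair_comm]
    push_cast
    refine congrArg₂ (fun a b : ℂ => ({a, b} : Set ℂ)) ?_ ?_
    · rw [show ∀ θ : ℂ, -(Complex.I * (Real.pi - θ)) = Complex.I * θ - Real.pi * Complex.I
        from fun θ => by ring, Complex.exp_sub, Complex.exp_pi_mul_I]
      ring
    · rw [show ∀ θ : ℂ, Complex.I * (Real.pi - θ) = Real.pi * Complex.I + -(Complex.I * θ)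
        from fun θ => by ring, Complex.exp_add, Complex.exp_pi_mul_I]
      ring
  · simp only [zR, ← smul_sub, norm_smul, Real.norm_eq_abs, abs_of_pos h, Set.image_pair,
      InnerProductGeometry.angle_smul_right_of_pos _ _ h]
    push_cast
    simp only [mul_div_assoc, mul_assoc]

theorem zR_comp_smul {L : Type*} [NormedAddCommGroup L] [InnerProductSpace ℝ L]
    (R : L → L) {α : ℝ} (hα : α ≠ 0) (u₁ u₂ : L) :
    zR (fun u => R (α • u)) u₁ u₂ = zR (fun u => α • R u) (α • u₁) (α • u₂) := by
  simp only [zR, ← smul_sub, norm_smul, InnerProductGeometry.angle_smul_smul hα,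
    mul_div_mul_left _ _ (norm_ne_zero_iff.mpr hα)]

theorem srg_scalar_mul {L : Type*} [NormedAddCommGroup L] [InnerProductSpace ℝ L]
    [CompleteSpace L] [Nontrivial L] (R : L → L) (α : ℝ) (hα : α ≠ 0) :
    SRG (fun u => α • R u) = SRG (fun u => R (α • u)) ∧
    SRG (fun u => α • R u) = (fun z : ℂ => (α : ℂ) * z) '' SRG R := by
  constructor
  · ext z
    simp only [SRG, Set.mem_iUnion, zR_comp_smul R hα]
    constructor
    · rintro ⟨u₁, u₂, hne, hz⟩
      refine ⟨α⁻¹ • u₁, α⁻¹ • u₂, fun h => hne (smul_right_injective L (inv_ne_zero hα) h), ?_⟩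
      simpa only [smul_inv_smul₀ hα] using hz
    · rintro ⟨u₁, u₂, hne, hz⟩
      exact ⟨α • u₁, α • u₂, fun h => hne (smul_right_injective L hα h), hz⟩
  · simp only [SRG, Set.image_iUnion, zR_const_smul R hα]
end

section
/- Let L be a nontrivial real Hilbert space and R : L → L an operator. Then SRG(I + R) = 1 + SRG(R), where I is the identity operator on L, I + R is the operator u ↦ u + R u, and 1 + SRG(R) := {1 + z : z ∈ SRG(R)} ⊆ ℂ. -/
open scoped Pointwise

/-- The conjugate pair `r · exp (± i θ)` consists of the complex numbers with real part `r cos θ`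
and squared modulus `r²`. -/
theorem mem_polar_pair_iff (r θ : ℝ) (z : ℂ) :
    z ∈ ({(r : ℂ) * Complex.exp (Complex.I * (θ : ℝ)),
        (r : ℂ) * Complex.exp (-(Complex.I * (θ : ℝ)))} : Set ℂ) ↔
      z.re = r * Real.cos θ ∧ Complex.normSq z = r ^ 2 := by
  have hpos : (r : ℂ) * Complex.exp (Complex.I * (θ : ℝ)) =
      ⟨r * Real.cos θ, r * Real.sin θ⟩ := by
    apply Complex.ext <;> simp [Complex.exp_re, Complex.exp_im]
  have hneg : (r : ℂ) * Complex.exp (-(Complex.I * (θ : ℝ))) =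
      ⟨r * Real.cos θ, -(r * Real.sin θ)⟩ := by
    apply Complex.ext <;> simp [Complex.exp_re, Complex.exp_im]
  rw [hpos, hneg, Set.mem_insert_iff, Set.mem_singleton_iff, Complex.ext_iff, Complex.ext_iff,
    ← and_or_left, ← sq_eq_sq_iff_eq_or_eq_neg, Complex.normSq_apply]
  refine and_congr_right fun hre => ?_
  rw [hre]
  constructor <;> intro h
  · linear_combination h + r ^ 2 * Real.sin_sq_add_cos_sq θ
  · linear_combination h - r ^ 2 * Real.sin_sq_add_cos_sq θ

/-- Membership in `zR` in terms of inner products. -/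
theorem mem_zR_iff {L : Type*} [NormedAddCommGroup L] [InnerProductSpace ℝ L]
    (R : L → L) {u₁ u₂ : L} (h : u₁ ≠ u₂) (z : ℂ) :
    z ∈ zR R u₁ u₂ ↔ z.re * ‖u₁ - u₂‖ ^ 2 = inner ℝ (u₁ - u₂) (R u₁ - R u₂) ∧
      Complex.normSq z * ‖u₁ - u₂‖ ^ 2 = ‖R u₁ - R u₂‖ ^ 2 := by
  have hd : ‖u₁ - u₂‖ ≠ 0 := norm_ne_zero_iff.mpr (sub_ne_zero.mpr h)
  rw [zR, mem_polar_pair_iff, ← InnerProductGeometry.cos_angle_mul_norm_mul_norm, div_pow,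
    eq_div_iff (pow_ne_zero 2 hd)]
  refine and_congr_left fun _ => ?_
  rw [div_mul_eq_mul_div, eq_div_iff hd, ← mul_left_inj' hd]
  ring_nf

/-- Adding the identity to an operator translates `zR` by one. -/
theorem one_add_mem_zR_iff {L : Type*} [NormedAddCommGroup L] [InnerProductSpace ℝ L]
    (R : L → L) {u₁ u₂ : L} (h : u₁ ≠ u₂) (z : ℂ) :
    1 + z ∈ zR (fun u => u + R u) u₁ u₂ ↔ z ∈ zR R u₁ u₂ := by
  rw [mem_zR_iff _ h, mem_zR_iff _ h, add_sub_add_comm, inner_add_right,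
    real_inner_self_eq_norm_sq, norm_add_sq_real]
  simp only [Complex.normSq_apply, Complex.add_re, Complex.add_im, Complex.one_re, Complex.one_im]
  constructor <;> rintro ⟨hre, hsq⟩ <;> constructor
  · linear_combination hre
  · linear_combination hsq - 2 * hre
  · linear_combination hre
  · linear_combination hsq + 2 * hre

theorem srg_add_identity {L : Type*} [NormedAddCommGroup L] [InnerProductSpace ℝ L]
    [CompleteSpace L] [Nontrivial L] (R : L → L) :
    SRG (fun u => u + R u) = (fun z : ℂ => 1 + z) '' SRG R := by
  ext z
  simp only [SRG, Set.mem_iUnion, Set.mem_image, exists_prop]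
  constructor
  · rintro ⟨u₁, u₂, h, hz⟩
    refine ⟨z - 1, ⟨u₁, u₂, h, (one_add_mem_zR_iff R h _).mp ?_⟩, add_sub_cancel 1 z⟩
    rwa [add_sub_cancel]
  · rintro ⟨w, ⟨u₁, u₂, h, hw⟩, rfl⟩
    exact ⟨u₁, u₂, h, (one_add_mem_zR_iff R h w).mpr hw⟩
end

section
/- Let L be a nontrivial real Hilbert space and R : L → L a bijective operator. Then SRG(R⁻¹) = {z⁻¹ : z ∈ SRG(R)}, where R⁻¹ is the inverse map of R. (Note that injectivity of R guarantees 0 ∉ SRG(R), so every z ∈ SRG(R) is invertible in ℂ; since SRG(R) is symmetric under complex conjugation, the set {z⁻¹ : z ∈ SRG(R)} coincides with the set of Möbius inversions {1/z̄ : z ∈ SRG(R)}.) -/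
open scoped Pointwise

/-- A left inverse of `R` swaps the roles of the two difference vectors, which inverts the pair
`zR R u₁ u₂`. -/
theorem zR_leftInverse {L : Type*} [NormedAddCommGroup L] [InnerProductSpace ℝ L]
    {R S : L → L} (hS : Function.LeftInverse S R) (u₁ u₂ : L) :
    zR S (R u₁) (R u₂) = (fun z : ℂ => z⁻¹) '' zR R u₁ u₂ := by
  simp only [zR, Set.image_pair, hS u₁, hS u₂, mul_inv, ← Complex.ofReal_inv, inv_div,
    ← Complex.exp_neg, neg_neg, InnerProductGeometry.angle_comm (R u₁ - R u₂)]
  exact Set.pair_comm _ _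

theorem srg_inverse {L : Type*} [NormedAddCommGroup L] [InnerProductSpace ℝ L]
    [CompleteSpace L] [Nontrivial L] (R : L → L) (hR : Function.Bijective R) :
    SRG (Function.invFun R) = (fun z : ℂ => z⁻¹) '' SRG R := by
  have hS := Function.leftInverse_invFun hR.injective
  simp only [SRG, Set.image_iUnion, ← zR_leftInverse hS]
  rw [← hR.surjective.iUnion_comp]
  refine Set.iUnion_congr fun u₁ => ?_
  rw [← hR.surjective.iUnion_comp]
  simp only [hR.injective.ne_iff]
end

section
/- Let (Ω, μ) be a measure space, L = L²(μ; ℝ), and let φ : ℝ → ℝ be measurable with φ(0) = 0 which satisfies the incremental sector condition ∂φ ∈ [k₁, k₂] for real numbers k₁ ≤ k₂, i.e., k₁·(x − y)² ≤ (φ(x) − φ(y))·(x − y) ≤ k₂·(x − y)² for all x, y ∈ ℝ. Let Φ : L → L be the static nonlinearity operator (Φu)(t) = φ(u(t)) (well-defined since φ is Lipschitz with φ(0) = 0). Then SRG(Φ) ⊆ D_{[k₁,k₂]}, the closed disk in ℂ centered at (k₁+k₂)/2 on the real axis with radius (k₂−k₁)/2. -/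
open scoped Pointwise

open MeasureTheory

/-- A sector bound on an increment says that its deviation from the central slope is bounded by
half the width of the sector. -/
theorem abs_sub_center_mul_le_of_sector {k₁ k₂ s d : ℝ} (hd : s = 0 → d = 0)
    (h₁ : k₁ * s ^ 2 ≤ d * s) (h₂ : d * s ≤ k₂ * s ^ 2) :
    |d - (k₁ + k₂) / 2 * s| ≤ (k₂ - k₁) / 2 * |s| := by
  rcases eq_or_ne s 0 with hs | hs
  · simp [hs, hd hs]
  · have hs' : 0 < |s| := abs_pos.mpr hs
    refine le_of_mul_le_mul_right ?_ hs'
    rw [← abs_mul, mul_assoc, abs_mul_abs_self, abs_le]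
    constructor <;> nlinarith

/-- If the increment of `R` deviates from `c` times the input increment by at most `r` times the
norm of the latter, then the points it contributes to the SRG lie within `r` of `c`. -/
theorem zR_subset_closedBall {L : Type*} [NormedAddCommGroup L] [InnerProductSpace ℝ L]
    {R : L → L} {u₁ u₂ : L} (hne : u₁ ≠ u₂) {c r : ℝ} (hr : 0 ≤ r)
    (h : ‖R u₁ - R u₂ - c • (u₁ - u₂)‖ ≤ r * ‖u₁ - u₂‖) :
    zR R u₁ u₂ ⊆ Metric.closedBall (c : ℂ) r := by
  have hx : 0 < ‖u₁ - u₂‖ := norm_pos_iff.mpr (sub_ne_zero.mpr hne)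
  unfold zR
  generalize u₁ - u₂ = x at *
  generalize R u₁ - R u₂ = y at *
  have hcos := InnerProductGeometry.cos_angle_mul_norm_mul_norm x y
  have hexp : ‖y - c • x‖ ^ 2 = ‖y‖ ^ 2 - 2 * (c * inner ℝ x y) + c ^ 2 * ‖x‖ ^ 2 := by
    rw [norm_sub_sq_real, inner_smul_right, norm_smul, mul_pow, Real.norm_eq_abs, sq_abs,
      real_inner_comm]
  have hsq : ‖y - c • x‖ ^ 2 ≤ (r * ‖x‖) ^ 2 := pow_le_pow_left₀ (norm_nonneg _) h 2
  generalize InnerProductGeometry.angle x y = θ at *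
  have hρ : ‖y‖ / ‖x‖ * ‖x‖ = ‖y‖ := div_mul_cancel₀ _ hx.ne'
  generalize ‖y‖ / ‖x‖ = ρ at *
  have hmain : ρ ^ 2 - 2 * c * ρ * Real.cos θ + c ^ 2 ≤ r ^ 2 := by
    refine le_of_mul_le_mul_right ?_ (pow_pos hx 2)
    rw [hexp, ← hcos, ← hρ] at hsq
    linarith
  have key : ∀ s : ℝ, Real.cos s = Real.cos θ →
      (ρ : ℂ) * Complex.exp (s * Complex.I) ∈ Metric.closedBall (c : ℂ) r := by
    intro s hs
    rw [mem_closedBall_iff_norm]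
    refine le_of_sq_le_sq ?_ hr
    rw [Complex.sq_norm, Complex.normSq_apply]
    simp only [Complex.sub_re, Complex.sub_im, Complex.re_ofReal_mul, Complex.im_ofReal_mul,
      Complex.exp_ofReal_mul_I_re, Complex.exp_ofReal_mul_I_im, Complex.ofReal_re,
      Complex.ofReal_im]
    rw [← hs] at hmain
    linear_combination hmain + ρ ^ 2 * Real.sin_sq_add_cos_sq s
  rintro z (rfl | rfl)
  · simpa [mul_comm] using key θ rfl
  · simpa [mul_comm] using key (-θ) (Real.cos_neg θ)

theorem srg_static_nonlinearity_incremental_sector {Ω : Type*} [MeasurableSpace Ω]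
    (μ : Measure Ω) (φ : ℝ → ℝ) (hφ_meas : Measurable φ) (hφ0 : φ 0 = 0)
    (k₁ k₂ : ℝ) (hk : k₁ ≤ k₂)
    (hsector : ∀ x y : ℝ,
      k₁ * (x - y) ^ 2 ≤ (φ x - φ y) * (x - y) ∧ (φ x - φ y) * (x - y) ≤ k₂ * (x - y) ^ 2)
    (Φ : Lp ℝ 2 μ → Lp ℝ 2 μ)
    (hΦ : ∀ u : Lp ℝ 2 μ, ∀ᵐ t ∂μ, (Φ u : Ω → ℝ) t = φ ((u : Ω → ℝ) t)) :
    SRG Φ ⊆ Metric.closedBall (((k₁ + k₂) / 2 : ℝ) : ℂ) ((k₂ - k₁) / 2) := by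
  have hr : 0 ≤ (k₂ - k₁) / 2 := by linarith
  refine Set.iUnion_subset fun u₁ => Set.iUnion_subset fun u₂ => Set.iUnion_subset fun hne =>
    zR_subset_closedBall hne hr (Lp.norm_le_mul_norm_of_ae_le_mul ?_)
  filter_upwards [hΦ u₁, hΦ u₂, Lp.coeFn_sub u₁ u₂, Lp.coeFn_sub (Φ u₁) (Φ u₂),
    Lp.coeFn_sub (Φ u₁ - Φ u₂) (((k₁ + k₂) / 2) • (u₁ - u₂)),
    Lp.coeFn_smul ((k₁ + k₂) / 2) (u₁ - u₂)] with t h₁ h₂ hu hΦu hsub hsmul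
  simp only [hsub, hsmul, hu, hΦu, h₁, h₂, Pi.sub_apply, Pi.smul_apply, smul_eq_mul,
    Real.norm_eq_abs]
  obtain ⟨hl, hg⟩ := hsector (u₁ t) (u₂ t)
  exact abs_sub_center_mul_le_of_sector (fun h => by rw [sub_eq_zero.mp h, sub_self]) hl hg
end

section
/- Let D = {ζ ∈ ℂ : |ζ − p| ≤ r_D} be a closed disk centered at a real point p with radius r_D ≥ 0. Let c ∈ ℝ, ρ > 0, and θ₁, θ₂ ∈ [0, π] with θ₁ ≤ θ₂, and set z_k = c + ρ·exp(i·θ_k) for k = 1, 2. If z₁ ∉ D and z₂ ∉ D, then c + ρ·exp(i·θ) ∉ D for every θ ∈ [θ₁, θ₂]. In other words, the complement of a disk centered on the real axis is h-convex: the arc of any circle centered on the real axis joining two points outside D within the closed upper half-plane stays outside D. (Consequently, taking the h-convex hull of a Nyquist diagram introduces no conservatism in the separation condition against a disk D_{[k₁,k₂]} centered on the real axis.) -/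
/-- A point of a circle centered on the real axis lies outside a closed disk centered on the real
axis iff an inequality affine in the cosine of its angle holds. -/
theorem real_centered_circle_notMem_closedBall_iff {r : ℝ} (hr : 0 ≤ r) (p c ρ θ : ℝ) :
    (c : ℂ) + (ρ : ℂ) * Complex.exp (Complex.I * θ) ∉ Metric.closedBall (p : ℂ) r ↔
      r ^ 2 < (c - p) ^ 2 + ρ ^ 2 + 2 * ((c - p) * ρ) * Real.cos θ := by
  have hsq : ‖(c : ℂ) + (ρ : ℂ) * Complex.exp (Complex.I * θ) - p‖ ^ 2 =
      (c - p) ^ 2 + ρ ^ 2 + 2 * ((c - p) * ρ) * Real.cos θ := by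
    rw [mul_comm Complex.I, Complex.exp_mul_I, ← Complex.ofReal_cos, ← Complex.ofReal_sin,
      Complex.sq_norm, Complex.normSq_apply]
    simp only [Complex.sub_re, Complex.add_re, Complex.mul_re, Complex.sub_im, Complex.add_im,
      Complex.mul_im, Complex.ofReal_re, Complex.ofReal_im, Complex.I_re, Complex.I_im]
    linear_combination ρ ^ 2 * Real.sin_sq_add_cos_sq θ
  rw [Metric.mem_closedBall, not_le, Complex.dist_eq, ← hsq,
    pow_lt_pow_iff_left₀ hr (norm_nonneg _) two_ne_zero]

theorem complement_of_real_centered_disk_is_hconvex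
    (p r_D : ℝ) (hr_D : 0 ≤ r_D) (c ρ : ℝ) (hρ : 0 < ρ)
    (θ₁ θ₂ : ℝ) (hθ₁ : θ₁ ∈ Set.Icc 0 Real.pi) (hθ₂ : θ₂ ∈ Set.Icc 0 Real.pi)
    (h₁₂ : θ₁ ≤ θ₂)
    (hz₁ : (c : ℂ) + (ρ : ℂ) * Complex.exp (Complex.I * θ₁) ∉
      Metric.closedBall (p : ℂ) r_D)
    (hz₂ : (c : ℂ) + (ρ : ℂ) * Complex.exp (Complex.I * θ₂) ∉
      Metric.closedBall (p : ℂ) r_D) :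
    ∀ θ ∈ Set.Icc θ₁ θ₂,
      (c : ℂ) + (ρ : ℂ) * Complex.exp (Complex.I * θ) ∉
        Metric.closedBall (p : ℂ) r_D := by
  rintro θ ⟨h₁, h₂⟩
  rw [real_centered_circle_notMem_closedBall_iff hr_D] at hz₁ hz₂ ⊢
  have hcos₁ : Real.cos θ ≤ Real.cos θ₁ :=
    Real.cos_le_cos_of_nonneg_of_le_pi hθ₁.1 (h₂.trans hθ₂.2) h₁
  have hcos₂ : Real.cos θ₂ ≤ Real.cos θ :=
    Real.cos_le_cos_of_nonneg_of_le_pi (hθ₁.1.trans h₁) hθ₂.2 h₂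
  rcases le_total 0 ((c - p) * ρ) with h | h
  · linarith [mul_le_mul_of_nonneg_left hcos₂ h]
  · linarith [mul_le_mul_of_nonpos_left hcos₁ h]
end
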